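/- For every ε ∈ (0,1), the function M_1 satisfies: (i) M_1 is strictly increasing on (0,1); (ii) M_1(ε) → 0 as ε → 0⁺; (iii) M_1(ε) → 1 as ε → 1⁻; (iv) M_1(ε) > ε for all ε ∈ (0,1). -/

import Mathlib

open MeasureTheory ProbabilityTheory Real Filter Set

noncomputable section

/-- The standard Gaussian measure on `ℝ`. -/
def stdGaussian : Measure ℝ := gaussianReal 0 1

/-- Soft thresholding, i.e. `η₁(u;χ) = sign(u)·max(|u|−χ,0)`. -/
def soft (u χ : ℝ) : ℝ := Real.sign u * max (|u| - χ) 0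

/-- `M₁(ε) = inf_{χ ≥ 0} [(1−ε)·E[η₁(Z;χ)²] + ε(1+χ²)]`, `Z ~ N(0,1)`. -/
def M1 (ε : ℝ) : ℝ :=
  ⨅ χ : NNReal, ((1 - ε) * ∫ z, (soft z (χ:ℝ))^2 ∂stdGaussian + ε * (1 + (χ:ℝ)^2))

instance : IsProbabilityMeasure stdGaussian :=
  inferInstanceAs (IsProbabilityMeasure (gaussianReal 0 1))

instance : stdGaussian.IsOpenPosMeasure :=
  (gaussianReal_absolutelyContinuous' 0 one_ne_zero).isOpenPosMeasure

lemma integral_pos_of_continuous_of_nonneg {f : ℝ → ℝ} (hc : Continuous f) (h0 : 0 ≤ f)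
    (hi : Integrable f stdGaussian) {x : ℝ} (hx : f x ≠ 0) : 0 < ∫ z, f z ∂stdGaussian :=
  (integral_pos_iff_support_of_nonneg h0 hi).2 (hc.isOpen_support.measure_pos _ ⟨x, hx⟩)

lemma memLp_id_stdGaussian : MemLp (fun z : ℝ ↦ z) 2 stdGaussian :=
  memLp_id_gaussianReal' 2 (by simp)

lemma integrable_abs_stdGaussian : Integrable (fun z : ℝ ↦ |z|) stdGaussian :=
  (memLp_id_stdGaussian.integrable (by norm_num)).abs

lemma integrable_sq_stdGaussian : Integrable (fun z : ℝ ↦ z ^ 2) stdGaussian :=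
  memLp_id_stdGaussian.integrable_sq

lemma integral_sq_stdGaussian : ∫ z, z ^ 2 ∂stdGaussian = 1 := by
  have h := variance_eq_sub memLp_id_stdGaussian
  have hv : Var[fun z : ℝ ↦ z; stdGaussian] = ((1 : NNReal) : ℝ) := variance_fun_id_gaussianReal
  have hm : ∫ z, z ∂stdGaussian = 0 := integral_id_gaussianReal
  rw [hv, hm] at h
  simpa using h.symm

lemma integral_abs_stdGaussian_pos : 0 < ∫ z, |z| ∂stdGaussian :=
  integral_pos_of_continuous_of_nonneg continuous_abs (fun z ↦ abs_nonneg z)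
    integrable_abs_stdGaussian (x := 1) (by simp)

lemma soft_sq {χ : ℝ} (hχ : 0 ≤ χ) (z : ℝ) : soft z χ ^ 2 = max (|z| - χ) 0 ^ 2 := by
  rcases lt_trichotomy z 0 with h | rfl | h
  · simp [soft, Real.sign_of_neg h]
  · simp [soft, hχ]
  · simp [soft, Real.sign_of_pos h]

lemma continuous_soft_sq {χ : ℝ} (hχ : 0 ≤ χ) : Continuous fun z ↦ soft z χ ^ 2 := by
  simp_rw [soft_sq hχ]
  fun_prop

lemma soft_sq_anti {χ χ' : ℝ} (hχ : 0 ≤ χ) (h : χ ≤ χ') (z : ℝ) :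
    soft z χ' ^ 2 ≤ soft z χ ^ 2 := by
  rw [soft_sq hχ, soft_sq (hχ.trans h)]
  gcongr

lemma soft_sq_le_sq {χ : ℝ} (hχ : 0 ≤ χ) (z : ℝ) : soft z χ ^ 2 ≤ z ^ 2 := by
  simpa [soft_sq le_rfl] using soft_sq_anti le_rfl hχ z

lemma soft_sq_le_sub_add {χ : ℝ} (hχ : 0 ≤ χ) (z : ℝ) :
    soft z χ ^ 2 ≤ z ^ 2 - 2 * χ * |z| + χ ^ 2 := by
  rw [soft_sq hχ, ← sq_abs z]
  rcases max_cases (|z| - χ) 0 with ⟨h, _⟩ | ⟨h, _⟩ <;> rw [h] <;> nlinarith [sq_nonneg (|z| - χ)]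

lemma integrable_soft_sq {χ : ℝ} (hχ : 0 ≤ χ) :
    Integrable (fun z ↦ soft z χ ^ 2) stdGaussian :=
  integrable_sq_stdGaussian.mono' (continuous_soft_sq hχ).aestronglyMeasurable
    (.of_forall fun z ↦ by simpa using soft_sq_le_sq hχ z)

/-- The risk of soft thresholding at level `χ` on pure standard Gaussian noise. -/
def noiseRisk (χ : ℝ) : ℝ := ∫ z, soft z χ ^ 2 ∂stdGaussian

lemma noiseRisk_nonneg (χ : ℝ) : 0 ≤ noiseRisk χ := integral_nonneg fun _ ↦ sq_nonneg _

lemma noiseRisk_anti {χ χ' : ℝ} (hχ : 0 ≤ χ) (h : χ ≤ χ') : noiseRisk χ' ≤ noiseRisk χ :=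
  integral_mono (integrable_soft_sq (hχ.trans h)) (integrable_soft_sq hχ) (soft_sq_anti hχ h)

lemma noiseRisk_pos {χ : ℝ} (hχ : 0 ≤ χ) : 0 < noiseRisk χ :=
  integral_pos_of_continuous_of_nonneg (continuous_soft_sq hχ) (fun _ ↦ sq_nonneg _)
    (integrable_soft_sq hχ) (x := χ + 1) (by
      rw [soft_sq hχ, abs_of_nonneg (by positivity)]
      simp)

lemma noiseRisk_le {χ : ℝ} (hχ : 0 ≤ χ) :
    noiseRisk χ ≤ 1 - 2 * χ * (∫ z, |z| ∂stdGaussian) + χ ^ 2 := by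
  have hi := integrable_abs_stdGaussian.const_mul (2 * χ)
  have hs : Integrable (fun z ↦ z ^ 2 - 2 * χ * |z|) stdGaussian :=
    integrable_sq_stdGaussian.sub hi
  calc noiseRisk χ ≤ ∫ z, (z ^ 2 - 2 * χ * |z| + χ ^ 2) ∂stdGaussian :=
        integral_mono (integrable_soft_sq hχ)
          (hs.add (integrable_const _)) (soft_sq_le_sub_add hχ)
    _ = _ := by
        rw [integral_add hs (integrable_const _),
          integral_sub integrable_sq_stdGaussian hi, integral_const_mul, integral_sq_stdGaussian]
        simp

lemma tendsto_noiseRisk_atTop : Tendsto noiseRisk atTop (nhds 0) := by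
  have h := tendsto_integral_filter_of_dominated_convergence (μ := stdGaussian) (l := atTop)
    (F := fun χ z ↦ soft z χ ^ 2) (f := fun _ ↦ 0) (fun z ↦ z ^ 2)
    ((eventually_ge_atTop 0).mono fun χ hχ ↦ (continuous_soft_sq hχ).aestronglyMeasurable)
    ((eventually_ge_atTop 0).mono fun χ hχ ↦
      .of_forall fun z ↦ by simpa using soft_sq_le_sq hχ z)
    integrable_sq_stdGaussian
    (.of_forall fun z ↦ tendsto_const_nhds.congr' <|
      (eventually_ge_atTop |z|).mono fun χ hχ ↦ by
        simp [soft_sq ((abs_nonneg z).trans hχ), hχ])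
  rwa [integral_zero] at h

lemma M1_le {ε χ : ℝ} (h0 : 0 ≤ ε) (h1 : ε ≤ 1) (hχ : 0 ≤ χ) :
    M1 ε ≤ (1 - ε) * noiseRisk χ + ε * (1 + χ ^ 2) := by
  refine ciInf_le (f := fun χ : NNReal ↦ (1 - ε) * noiseRisk χ + ε * (1 + (χ : ℝ) ^ 2))
    ⟨0, ?_⟩ (⟨χ, hχ⟩ : NNReal)
  rintro _ ⟨χ, rfl⟩
  have := noiseRisk_nonneg χ
  have : 0 ≤ 1 - ε := by linarith
  positivity

lemma le_M1 {ε c : ℝ} (h : ∀ χ, 0 ≤ χ → c ≤ (1 - ε) * noiseRisk χ + ε * (1 + χ ^ 2)) :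
    c ≤ M1 ε :=
  le_ciInf fun χ : NNReal ↦ h χ χ.2

lemma M1_lt_one {ε : ℝ} (h0 : 0 ≤ ε) (h1 : ε < 1) : M1 ε < 1 := by
  set m := ∫ z, |z| ∂stdGaussian
  have hm0 : 0 < m := integral_abs_stdGaussian_pos
  have h1' : 0 < 1 - ε := by linarith
  have hχ : 0 < (1 - ε) * m := by positivity
  have hle := mul_le_mul_of_nonneg_left (noiseRisk_le hχ.le) h1'.le
  have := M1_le h0 h1.le hχ.le
  nlinarith [pow_pos hχ 2]

lemma lt_M1 {ε : ℝ} (h0 : 0 < ε) (h1 : ε < 1) : ε < M1 ε := by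
  have h1' : 0 < 1 - ε := by linarith
  have hr := mul_pos h1' (noiseRisk_pos zero_le_one)
  refine lt_of_lt_of_le (lt_add_of_pos_right ε (lt_min hr h0)) (le_M1 fun χ hχ ↦ ?_)
  rcases le_total χ 1 with h | h
  · have := mul_le_mul_of_nonneg_left (noiseRisk_anti hχ h) h1'.le
    have := min_le_left ((1 - ε) * noiseRisk 1) ε
    nlinarith [mul_nonneg h0.le (sq_nonneg χ)]
  · have := mul_nonneg h1'.le (noiseRisk_nonneg χ)
    have := min_le_right ((1 - ε) * noiseRisk 1) ε
    nlinarith [mul_le_mul_of_nonneg_left (one_le_pow₀ h : 1 ≤ χ ^ 2) h0.le]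

lemma strictMonoOn_M1 : StrictMonoOn M1 (Ioo (0 : ℝ) 1) := by
  intro a ha b hb hab
  have ha' : 0 < 1 - a := by linarith [ha.2]
  set t := (b - a) / (1 - a) with ht
  have ht0 : 0 < t := div_pos (by linarith) ha'
  have ht1 : 0 ≤ 1 - t := by
    rw [sub_nonneg, ht, div_le_one ha']
    linarith [hb.2]
  have hb' : b = (1 - t) * a + t := by
    rw [ht]
    field_simp
    ring
  have hconc : (1 - t) * M1 a + t ≤ M1 b := le_M1 fun χ hχ ↦ by
    have := mul_le_mul_of_nonneg_left (M1_le ha.1.le ha.2.le hχ) ht1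
    rw [hb']
    nlinarith [mul_nonneg ht0.le (sq_nonneg χ)]
  nlinarith [mul_pos ht0 (sub_pos.2 (M1_lt_one ha.1.le ha.2))]

lemma tendsto_M1_zero : Tendsto M1 (nhdsWithin (0 : ℝ) (Ioi 0)) (nhds 0) := by
  have hmem : Ioo (0 : ℝ) 1 ∈ nhdsWithin (0 : ℝ) (Ioi 0) := Ioo_mem_nhdsGT one_pos
  refine tendsto_order.2 ⟨fun c hc ↦ ?_, fun c hc ↦ ?_⟩
  · filter_upwards [hmem] with ε hε
    exact hc.trans (hε.1.trans (lt_M1 hε.1 hε.2))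
  · obtain ⟨χ, hχc, hχ⟩ :=
      ((tendsto_noiseRisk_atTop.eventually_lt_const hc).and (eventually_ge_atTop 0)).exists
    have hcont : Continuous fun ε : ℝ ↦ (1 - ε) * noiseRisk χ + ε * (1 + χ ^ 2) := by fun_prop
    have hlim := (hcont.tendsto 0).mono_left (nhdsWithin_le_nhds (s := Ioi 0))
    filter_upwards [hmem, hlim.eventually_lt_const (by simpa using hχc)] with ε hε h
    exact (M1_le hε.1.le hε.2.le hχ).trans_lt h

lemma tendsto_M1_one : Tendsto M1 (nhdsWithin (1 : ℝ) (Iio 1)) (nhds 1) := by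
  have hmem : Ioo (0 : ℝ) 1 ∈ nhdsWithin (1 : ℝ) (Iio 1) := Ioo_mem_nhdsLT one_pos
  refine tendsto_of_tendsto_of_tendsto_of_le_of_le' (g := fun ε ↦ ε)
    (tendsto_id.mono_left nhdsWithin_le_nhds) tendsto_const_nhds ?_ ?_
  · filter_upwards [hmem] with ε hε using (lt_M1 hε.1 hε.2).le
  · filter_upwards [hmem] with ε hε using (M1_lt_one hε.1.le hε.2).le

/-- Properties of `M₁`: strictly increasing on (0,1), limits 0 and 1 at the endpoints,
and `M₁(ε) > ε` on (0,1). -/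
theorem M1_properties :
    StrictMonoOn M1 (Ioo (0:ℝ) 1) ∧
    Tendsto M1 (nhdsWithin (0:ℝ) (Ioi 0)) (nhds 0) ∧
    Tendsto M1 (nhdsWithin (1:ℝ) (Iio 1)) (nhds 1) ∧
    ∀ ε ∈ Ioo (0:ℝ) 1, ε < M1 ε :=
  ⟨strictMonoOn_M1, tendsto_M1_zero, tendsto_M1_one, fun _ hε ↦ lt_M1 hε.1 hε.2⟩
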